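/- Let (C, S, N, f) be an automaton. If f has invariant histories and is monotonic, then f is commutative. -/

import Mathlib

namespace AsyncUpdating

variable {C S : Type*}

/-- `f` is a transition function for the neighborhood function `N`:
`f ξ x` depends only on the restriction of `ξ` to `N x`. -/
def IsTransition (N : C → Set C) (f : (C → S) → C → S) : Prop :=
  ∀ (ξ₁ ξ₂ : C → S) (x : C), (∀ y ∈ N x, ξ₁ y = ξ₂ y) → f ξ₁ x = f ξ₂ x

/-- The automaton is local: every neighborhood is finite. -/
def IsLocal (N : C → Set C) : Prop := ∀ x, (N x).Finite

open Classical in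
/-- `upd f ξ E` is the configuration `f(ξ, E)`: apply `f` at the sites of `E` only. -/
noncomputable def upd (f : (C → S) → C → S) (ξ : C → S) (E : Set C) : C → S :=
  fun x => if x ∈ E then f ξ x else ξ x

/-- The set `L(ξ)` of free sites. -/
def freeSet (f : (C → S) → C → S) (ξ : C → S) : Set C := {x | f ξ x ≠ ξ x}

/-- `η` is an asynchronous trajectory of `f`. -/
def IsAsyncTraj (f : (C → S) → C → S) (η : C → ℕ → S) : Prop :=
  ∀ x t, η x (t + 1) ≠ η x t → η x (t + 1) = f (fun y => η y t) x

/-- `η` is a synchronous trajectory of `f`. -/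
def IsSyncTraj (f : (C → S) → C → S) (η : C → ℕ → S) : Prop :=
  ∀ x t, η x (t + 1) = f (fun y => η y t) x

/-- The synchronous trajectory of `f` with initial configuration `ξ`. -/
def syncTraj (f : (C → S) → C → S) (ξ : C → S) : ℕ → C → S
  | 0 => ξ
  | t + 1 => f (syncTraj f ξ t)

/-- The update set `U(t, η)`. -/
def updSet (η : C → ℕ → S) (t : ℕ) : Set C := {x | η x (t + 1) ≠ η x t}

open Classical in
/-- The effective age `τ(x, t, η)`: the number of `s < t` with `x ∈ U(s, η)`. -/
noncomputable def effAge (η : C → ℕ → S) (x : C) (t : ℕ) : ℕ :=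
  ((Finset.range t).filter fun s => η x (s + 1) ≠ η x s).card

/-- `f` has invariant histories. -/
def InvariantHistories (f : (C → S) → C → S) : Prop :=
  ∀ ξ : C → S, ∃ ζ : C → ℕ → S, ∀ η : C → ℕ → S,
    IsAsyncTraj f η → (∀ x, η x 0 = ξ x) → ∀ x t, η x t = ζ x (effAge η x t)

/-- `f` is monotonic: `L(t,η) \ U(t,η) ⊆ L(t+1,η)` for every asynchronous trajectory. -/
def Monotonic (f : (C → S) → C → S) : Prop :=
  ∀ η : C → ℕ → S, IsAsyncTraj f η → ∀ t,
    freeSet f (fun x => η x t) \ updSet η t ⊆ freeSet f (fun x => η x (t + 1))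

/-- `f` is commutative. -/
def CommutativeRule (f : (C → S) → C → S) : Prop :=
  ∀ (ξ : C → S) (A B : Set C), Disjoint A B →
    A ⊆ freeSet f ξ → B ⊆ freeSet f ξ →
    upd f (upd f ξ A) B = upd f ξ (A ∪ B)

/-- `f` is locally commutative. -/
def LocallyCommutative (f : (C → S) → C → S) : Prop :=
  ∀ (ξ : C → S) (x y : C), x ≠ y → x ∈ freeSet f ξ → y ∈ freeSet f ξ →
    upd f (upd f ξ {x}) {y} = upd f ξ {x, y}

/-- `η₁` dominates `η₀` (they are assumed to have the same initial configuration). -/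
def Dominates (η₁ η₀ : C → ℕ → S) : Prop :=
  (∀ x t, effAge η₀ x t ≤ effAge η₁ x t) ∧
  (∀ x t₀ t₁, effAge η₀ x t₀ = effAge η₁ x t₁ → η₀ x t₀ = η₁ x t₁)

theorem effAge_zero (η : C → ℕ → S) (x : C) : effAge η x 0 = 0 := by
  simp [effAge]

theorem effAge_succ_of_eq {η : C → ℕ → S} {x : C} {t : ℕ} (h : η x (t + 1) = η x t) :
    effAge η x (t + 1) = effAge η x t := by
  simp [effAge, Finset.range_add_one, Finset.filter_insert, h]

theorem effAge_succ_of_ne {η : C → ℕ → S} {x : C} {t : ℕ} (h : η x (t + 1) ≠ η x t) :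
    effAge η x (t + 1) = effAge η x t + 1 := by
  simp [effAge, Finset.range_add_one, Finset.filter_insert, h]

/-- The history that updates at `A`, then at `B`, and then stays constant. -/
noncomputable def twoStep (f : (C → S) → C → S) (ξ : C → S) (A B : Set C) (x : C) : ℕ → S
  | 0 => ξ x
  | 1 => upd f ξ A x
  | _ + 2 => upd f (upd f ξ A) B x

theorem upd_of_mem {f : (C → S) → C → S} {ξ : C → S} {E : Set C} {x : C} (h : x ∈ E) :
    upd f ξ E x = f ξ x := if_pos h

theorem upd_of_notMem {f : (C → S) → C → S} {ξ : C → S} {E : Set C} {x : C} (h : x ∉ E) :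
    upd f ξ E x = ξ x := if_neg h

theorem upd_eq_of_ne {f : (C → S) → C → S} {ξ : C → S} {E : Set C} {x : C}
    (h : upd f ξ E x ≠ ξ x) : upd f ξ E x = f ξ x :=
  upd_of_mem (by_contra fun hx => h (upd_of_notMem hx))

theorem isAsyncTraj_twoStep (f : (C → S) → C → S) (ξ : C → S) (A B : Set C) :
    IsAsyncTraj f (twoStep f ξ A B) := by
  intro x t h
  match t with
  | 0 => exact upd_eq_of_ne h
  | 1 => exact upd_eq_of_ne h
  | _ + 2 => exact absurd rfl h

/-- Let (C, S, N, f) be an automaton. If f has invariant histories and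
is monotonic, then f is commutative. -/
theorem commutative_of_invariantHistories_of_monotonic
    {C S : Type*} (N : C → Set C) (f : (C → S) → C → S)
    (hf : IsTransition N f)
    (hih : InvariantHistories f) (hmono : Monotonic f) :
    CommutativeRule f := by
  intro ξ A B hAB hA hB
  funext x
  by_cases hxB : x ∈ B
  · have hxA : x ∉ A := fun h => Set.disjoint_left.mp hAB h hxB
    obtain ⟨ζ, hζ⟩ := hih ξ
    have h₁ := hζ (twoStep f ξ A B) (isAsyncTraj_twoStep f ξ A B) (fun _ => rfl) x 2
    have h₂ := hζ (twoStep f ξ (A ∪ B) ∅) (isAsyncTraj_twoStep f ξ (A ∪ B) ∅) (fun _ => rfl) x 1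
    have hfree : f (upd f ξ A) x ≠ upd f ξ A x :=
      hmono _ (isAsyncTraj_twoStep f ξ A B) 0 ⟨hB hxB, fun h => h (upd_of_notMem hxA)⟩
    have hne : f ξ x ≠ ξ x := hB hxB
    have e₁ : effAge (twoStep f ξ A B) x 2 = 1 := by
      have h₀ : twoStep f ξ A B x 1 = twoStep f ξ A B x 0 := upd_of_notMem hxA
      have h₁ : twoStep f ξ A B x 2 ≠ twoStep f ξ A B x 1 := fun h =>
        hfree ((upd_of_mem hxB).symm.trans h)
      rw [effAge_succ_of_ne h₁, effAge_succ_of_eq h₀, effAge_zero]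
    have e₂ : effAge (twoStep f ξ (A ∪ B) ∅) x 1 = 1 := by
      have h₀ : twoStep f ξ (A ∪ B) ∅ x 1 ≠ twoStep f ξ (A ∪ B) ∅ x 0 := fun h =>
        hne ((upd_of_mem (Set.mem_union_right A hxB)).symm.trans h)
      rw [effAge_succ_of_ne h₀, effAge_zero]
    rw [e₁] at h₁
    rw [e₂] at h₂
    exact h₁.trans h₂.symm
  · rw [upd_of_notMem hxB]
    by_cases hxA : x ∈ A
    · rw [upd_of_mem hxA, upd_of_mem (Set.mem_union_left B hxA)]
    · rw [upd_of_notMem hxA, upd_of_notMem fun h => h.elim hxA hxB]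

end AsyncUpdating
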